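/- arXiv:math/0302150 — 2 statements merged into one kernel-verified Lean document; each statement's English description precedes it below -/
import Mathlib

section
/- (Theorem 2.3.) Let f : ℂ → ℂ be infinitely differentiable (ContDiff ℝ ⊤). The following are equivalent: (i) there exists an infinitely differentiable function F : ℝ × ℝ → ℂ which is 2π-periodic in its second variable (F(s, θ + 2π) = F(s, θ) for all s, θ) and satisfies F(s, θ) = f(exp(−iθ)·√s) for all s ≥ 0 and all θ; (ii) the infinite jet of f at 0 is even, i.e. for every n, the n-th iterated derivative of f at 0 coincides with the n-th iterated derivative at 0 of the function z ↦ f(−z). -/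
open Complex

open MeasureTheory

theorem iteratedFDeriv_comp_perm_of_smooth {E F : Type*} [NormedAddCommGroup E] [NormedSpace ℝ E]
    [NormedAddCommGroup F] [NormedSpace ℝ F] {h : E → F} (hh : ContDiff ℝ (⊤ : ℕ∞) h) :
    ∀ (n : ℕ) (σ : Equiv.Perm (Fin n)) (x : E) (v : Fin n → E),
      iteratedFDeriv ℝ n h x (v ∘ σ) = iteratedFDeriv ℝ n h x v := by
  have hsmooth : ∀ n, ContDiff ℝ (⊤ : ℕ∞) (iteratedFDeriv ℝ n h) := fun n =>
    hh.iteratedFDeriv_right (by exact_mod_cast le_top)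
  have hdiff : ∀ n, Differentiable ℝ (iteratedFDeriv ℝ n h) := fun n =>
    (hsmooth n).differentiable (by simp)
  have key : ∀ (n : ℕ) (i : Fin n) (x : E) (v : Fin (n + 1) → E),
      iteratedFDeriv ℝ (n + 1) h x (v ∘ Equiv.swap i.castSucc i.succ)
        = iteratedFDeriv ℝ (n + 1) h x v := by
    intro n
    induction n with
    | zero => exact fun i => i.elim0
    | succ n ih =>
      intro i x v
      refine Fin.cases ?_ (fun j => ?_) i
      · have hsym := ((hsmooth n).contDiffAt (x := x)).isSymmSndFDerivAt
          (by simpa using (WithTop.coe_le_coe.2 le_top : ((2 : ℕ∞) : WithTop ℕ∞) ≤ (⊤ : ℕ∞)))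
        have expand : ∀ w : Fin (n + 2) → E, iteratedFDeriv ℝ (n + 2) h x w =
            fderiv ℝ (fderiv ℝ (iteratedFDeriv ℝ n h)) x (w 0) (w 1) (Fin.tail (Fin.tail w)) := by
          intro w
          rw [iteratedFDeriv_succ_apply_left]
          have h1 : (fun y => iteratedFDeriv ℝ (n + 1) h y (Fin.tail w)) =
              fun y => fderiv ℝ (iteratedFDeriv ℝ n h) y (w 1) (Fin.tail (Fin.tail w)) := by
            funext y
            rw [iteratedFDeriv_succ_apply_left]
            rfl
          have h2 : DifferentiableAt ℝ (fderiv ℝ (iteratedFDeriv ℝ n h)) x :=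
            ((hsmooth n).fderiv_right (m := (⊤ : ℕ∞)) (by simp)).differentiable (by simp) x
          have h3 := fderiv_continuousMultilinear_apply_const_apply (hdiff (n + 1) x) (Fin.tail w)
            (w 0)
          rw [← h3, h1]
          have h4 := (h2.clm_apply (differentiableAt_const (w 1)))
          rw [fderiv_continuousMultilinear_apply_const_apply h4,
            fderiv_clm_apply h2 (differentiableAt_const _)]
          simp
        rw [expand, expand, Function.comp_apply, Function.comp_apply]
        have e0 : Equiv.swap (Fin.castSucc (0 : Fin (n + 1))) (Fin.succ 0) 0 = 1 := by
          simp
        have e1 : Equiv.swap (Fin.castSucc (0 : Fin (n + 1))) (Fin.succ 0) 1 = 0 := by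
          simp
        rw [e0, e1, hsym.eq (v 1) (v 0)]
        congr 1
      · rw [iteratedFDeriv_succ_apply_left, iteratedFDeriv_succ_apply_left]
        have e0 : Equiv.swap (Fin.castSucc j.succ) (Fin.succ j.succ) 0 = 0 :=
          Equiv.swap_apply_of_ne_of_ne (by simp [Fin.ext_iff]) (by simp [Fin.ext_iff])
        have et : Fin.tail (v ∘ Equiv.swap (Fin.castSucc j.succ) (Fin.succ j.succ)) =
            Fin.tail v ∘ Equiv.swap j.castSucc j.succ := by
          funext k
          simp only [Fin.tail, Function.comp_apply]
          congr 1
          rw [← Fin.succ_castSucc]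
          simp only [Equiv.swap_apply_def, Fin.succ_inj]
          split_ifs <;> rfl
        rw [Function.comp_apply, e0, et,
          ← fderiv_continuousMultilinear_apply_const_apply (hdiff (n + 1) x),
          ← fderiv_continuousMultilinear_apply_const_apply (hdiff (n + 1) x)]
        simp_rw [ih j]
  intro n
  cases n with
  | zero => intro σ x v; congr 1; exact Subsingleton.elim _ _
  | succ n =>
    intro σ
    have hσ : σ ∈ Submonoid.closure
        (Set.range fun i : Fin n => Equiv.swap i.castSucc i.succ) := by
      rw [Equiv.Perm.mclosure_swap_castSucc_succ]; trivial
    induction hσ using Submonoid.closure_induction with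
    | mem τ hτ => obtain ⟨i, rfl⟩ := hτ; exact key n i
    | one => intro x v; rfl
    | mul σ τ _ _ hs ht =>
      intro x v
      rw [← hs x v, ← ht x (v ∘ σ)]
      rfl

theorem iteratedFDeriv_eq_zero_of_diagonal {E F : Type*} [NormedAddCommGroup E] [NormedSpace ℝ E]
    [NormedAddCommGroup F] [NormedSpace ℝ F] {h : E → F} (hh : ContDiff ℝ (⊤ : ℕ∞) h)
    {n : ℕ} {x : E} (hd : ∀ v : E, iteratedFDeriv ℝ n h x (fun _ => v) = 0) :
    iteratedFDeriv ℝ n h x = 0 := by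
  ext v
  have h1 := (iteratedFDeriv ℝ n h x).iteratedFDeriv_comp_diagonal x v
  simp_rw [hd] at h1
  have h2 : ∀ σ : Equiv.Perm (Fin n), iteratedFDeriv ℝ n h x (fun i => v (σ i)) =
      iteratedFDeriv ℝ n h x v := fun σ => iteratedFDeriv_comp_perm_of_smooth hh n σ x v
  simp_rw [h2] at h1
  rw [Finset.sum_const, show (fun _ : E => (0 : F)) = 0 from rfl, iteratedFDeriv_zero] at h1
  have h3 : ((Finset.univ : Finset (Equiv.Perm (Fin n))).card : ℕ) ≠ 0 := by
    simp [Fintype.card_ne_zero]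
  rw [← Nat.cast_smul_eq_nsmul ℝ] at h1
  have := (smul_eq_zero.1 h1.symm).resolve_left (by exact_mod_cast h3)
  simpa using this

theorem iteratedFDeriv_diagonal {E F : Type*} [NormedAddCommGroup E] [NormedSpace ℝ E]
    [NormedAddCommGroup F] [NormedSpace ℝ F] {h : E → F} (hh : ContDiff ℝ (⊤ : ℕ∞) h)
    (n : ℕ) (v : E) :
    iteratedFDeriv ℝ n h 0 (fun _ => v) = iteratedDeriv n (fun r : ℝ => h (r • v)) 0 := by
  have h1 := (ContinuousLinearMap.toSpanSingleton ℝ v).iteratedFDeriv_comp_right hh 0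
    (i := n) (by exact_mod_cast le_top)
  rw [iteratedDeriv_eq_iteratedFDeriv]
  have h2 : (fun r : ℝ => h (r • v)) = h ∘ ContinuousLinearMap.toSpanSingleton ℝ v := by
    funext r; simp
  rw [h2, h1]
  simp

theorem iteratedDeriv_eq_of_eqOn_Ici {F : Type*} [NormedAddCommGroup F] [NormedSpace ℝ F]
    {g h : ℝ → F} {n : ℕ} (hg : ContDiff ℝ n g) (hh : ContDiff ℝ n h)
    (heq : Set.EqOn g h (Set.Ici 0)) : iteratedDeriv n g 0 = iteratedDeriv n h 0 := by
  have h0 : (0 : ℝ) ∈ Set.Ici (0 : ℝ) := Set.self_mem_Ici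
  rw [← iteratedDerivWithin_eq_iteratedDeriv (uniqueDiffOn_Ici 0) hg.contDiffAt h0,
    ← iteratedDerivWithin_eq_iteratedDeriv (uniqueDiffOn_Ici 0) hh.contDiffAt h0]
  exact iteratedDerivWithin_congr heq h0

theorem jet_even_of_extension {f : ℂ → ℂ} (hf : ContDiff ℝ (⊤ : ℕ∞) f) {F : ℝ × ℝ → ℂ}
    (hF : ContDiff ℝ (⊤ : ℕ∞) F)
    (hFf : ∀ s θ : ℝ, 0 ≤ s → F (s, θ) = f (exp (-I * θ) * Real.sqrt s)) (n : ℕ) :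
    iteratedFDeriv ℝ n f 0 = iteratedFDeriv ℝ n (fun z => f (-z)) 0 := by
  have hfn : ContDiff ℝ (⊤ : ℕ∞) (fun z => f (-z)) := hf.comp contDiff_neg
  have hk : ContDiff ℝ (⊤ : ℕ∞) (f - fun z => f (-z)) := hf.sub hfn
  have hle : ((n : ℕ) : WithTop ℕ∞) ≤ (⊤ : ℕ∞) := by exact_mod_cast le_top
  rw [← sub_eq_zero, ← iteratedFDeriv_sub_apply ((hf.of_le hle).contDiffAt)
    ((hfn.of_le hle).contDiffAt)]
  refine iteratedFDeriv_eq_zero_of_diagonal hk fun v => ?_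
  rw [iteratedFDeriv_diagonal hk]
  set θ : ℝ := -arg v with hθ
  set ρ : ℝ := ‖v‖ with hρ
  have hv : v = ρ * exp (-I * θ) := by
    conv_lhs => rw [← norm_mul_exp_arg_mul_I v]
    rw [hθ, hρ]; push_cast; ring_nf
  set κ : ℝ → ℂ := fun r => (f - fun z => f (-z)) (r • v) with hκ
  set G : ℝ → ℂ := fun r => F ((r * ρ) ^ 2, θ) - F ((r * ρ) ^ 2, θ + Real.pi) with hG
  have hκs : ContDiff ℝ n κ := (hk.of_le hle).comp (by fun_prop)
  have hGs : ContDiff ℝ n G := by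
    refine ContDiff.sub ?_ ?_ <;> exact (hF.of_le hle).comp (by fun_prop)
  have heq : iteratedDeriv n κ 0 = iteratedDeriv n G 0 := by
    refine iteratedDeriv_eq_of_eqOn_Ici hκs hGs fun r hr => ?_
    have hr0 : 0 ≤ r * ρ := mul_nonneg hr (norm_nonneg v)
    have e1 : exp (-I * θ) * ((r * ρ : ℝ) : ℂ) = r • v := by
      rw [hv, real_smul]; push_cast; ring
    have e2 : exp (-I * ((θ + Real.pi : ℝ) : ℂ)) = - exp (-I * θ) := by
      push_cast
      rw [mul_add, exp_add, show -I * (Real.pi : ℂ) = -(Real.pi * I) by ring, exp_neg (Real.pi * I),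
        exp_pi_mul_I]
      norm_num
    simp only [hκ, hG, Pi.sub_apply]
    rw [hFf _ _ (sq_nonneg _), hFf _ _ (sq_nonneg _), Real.sqrt_sq hr0, e2, neg_mul (exp _), e1]
  have hodd : iteratedDeriv n κ 0 = -((-1 : ℝ) ^ n • iteratedDeriv n κ 0) := by
    have h1 : (fun r => κ (-r)) = fun r => - κ r := by
      funext r; simp [hκ]
    have h2 := iteratedDeriv_comp_neg n κ 0
    rw [h1, neg_zero, iteratedDeriv_fun_neg] at h2
    rw [← h2, neg_neg]
  have heven : iteratedDeriv n G 0 = (-1 : ℝ) ^ n • iteratedDeriv n G 0 := by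
    have h1 : (fun r => G (-r)) = G := by
      funext r; simp [hG]
    have h2 := iteratedDeriv_comp_neg n G 0
    rwa [h1, neg_zero] at h2
  rw [← heq] at heven
  have : iteratedDeriv n κ 0 = - iteratedDeriv n κ 0 := by
    rw [← heven] at hodd; exact hodd
  exact self_eq_neg.1 this

theorem exists_norm_le_pow_of_flat (N : ℕ) : ∀ {E F : Type} [NormedAddCommGroup E]
    [NormedSpace ℝ E] [FiniteDimensional ℝ E] [NormedAddCommGroup F] [NormedSpace ℝ F] {g : E → F},
    ContDiff ℝ (⊤ : ℕ∞) g → (∀ n, iteratedFDeriv ℝ n g 0 = 0) →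
    ∃ C : ℝ, 0 ≤ C ∧ ∀ z : E, ‖z‖ ≤ 1 → ‖g z‖ ≤ C * ‖z‖ ^ N := by
  induction N with
  | zero =>
    intro E F _ _ _ _ _ g hg _
    have : ProperSpace E := FiniteDimensional.proper_real E
    obtain ⟨C, hC⟩ := (isCompact_closedBall (0 : E) 1).exists_bound_of_continuousOn
      hg.continuous.continuousOn
    refine ⟨max C 0, le_max_right _ _, fun z hz => ?_⟩
    simpa using Or.inl (hC z (by simpa using hz))
  | succ N ih =>
    intro E F _ _ _ _ _ g hg hz
    have hg' : ContDiff ℝ (⊤ : ℕ∞) (fderiv ℝ g) := hg.fderiv_right (by simp)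
    have hz' : ∀ n, iteratedFDeriv ℝ n (fderiv ℝ g) 0 = 0 := by
      intro n
      rw [← norm_eq_zero, norm_iteratedFDeriv_fderiv, hz, norm_zero]
    obtain ⟨C, hC0, hC⟩ := ih hg' hz'
    refine ⟨C, hC0, fun z hz1 => ?_⟩
    have g0 : g 0 = 0 := by
      rw [← norm_eq_zero, ← norm_iteratedFDeriv_zero (𝕜 := ℝ), hz, norm_zero]
    have := (convex_closedBall (0 : E) ‖z‖).norm_image_sub_le_of_norm_fderiv_le
      (f := g) (C := C * ‖z‖ ^ N) (x := 0) (y := z) (𝕜 := ℝ)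
      (fun x _ => hg.differentiable (by simp) x) (fun x hx => ?_) (by simp) (by simp)
    · rw [g0, sub_zero, sub_zero] at this
      rwa [pow_succ, ← mul_assoc]
    · have hx' : ‖x‖ ≤ ‖z‖ := by simpa using hx
      refine (hC x (hx'.trans hz1)).trans ?_
      gcongr

theorem flat_fderiv_apply {g : ℂ → ℂ} (hg : ContDiff ℝ (⊤ : ℕ∞) g)
    (hz : ∀ n, iteratedFDeriv ℝ n g 0 = 0) (A : ℂ →L[ℝ] ℂ) :
    ContDiff ℝ (⊤ : ℕ∞) (fun z => fderiv ℝ g z (A z)) ∧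
      ∀ n, iteratedFDeriv ℝ n (fun z => fderiv ℝ g z (A z)) 0 = 0 := by
  have hg' : ContDiff ℝ (⊤ : ℕ∞) (fderiv ℝ g) := hg.fderiv_right (by simp)
  refine ⟨hg'.clm_apply A.contDiff, fun n => ?_⟩
  have := norm_iteratedFDeriv_clm_apply hg' A.contDiff (0 : ℂ) (n := n) (by exact_mod_cast le_top)
  simp only [norm_iteratedFDeriv_fderiv, hz, norm_zero, mul_zero, zero_mul,
    Finset.sum_const_zero] at this
  exact norm_le_zero_iff.1 this

/-- The blow-down map `(s, θ) ↦ e^{-iθ}√s`. -/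
noncomputable def blowDown (p : ℝ × ℝ) : ℂ := exp (-I * p.2) * Real.sqrt p.1

theorem norm_blowDown (p : ℝ × ℝ) : ‖blowDown p‖ = Real.sqrt p.1 := by
  have : ‖exp (-I * p.2)‖ = 1 := by
    rw [show -I * (p.2 : ℂ) = ((-p.2 : ℝ) : ℂ) * I by push_cast; ring, norm_exp_ofReal_mul_I]
  rw [blowDown, norm_mul, this, one_mul, norm_real, Real.norm_of_nonneg (Real.sqrt_nonneg _)]

theorem hasFDerivAt_blowDown {p : ℝ × ℝ} (hp : 0 < p.1) :
    HasFDerivAt blowDown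
      ((ContinuousLinearMap.fst ℝ ℝ ℝ).smulRight ((p.1⁻¹ / 2 : ℝ) • blowDown p) +
        (ContinuousLinearMap.snd ℝ ℝ ℝ).smulRight (-I * blowDown p)) p := by
  have h1 : HasFDerivAt (fun p : ℝ × ℝ => ((Real.sqrt p.1 : ℝ) : ℂ)) _ p :=
    (ofRealCLM.hasFDerivAt (x := Real.sqrt p.1)).comp p
      (((Real.hasDerivAt_sqrt hp.ne').hasFDerivAt).comp p hasFDerivAt_fst)
  have h2 : HasFDerivAt (fun p : ℝ × ℝ => exp (-I * p.2)) _ p :=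
    (((ofRealCLM.hasFDerivAt (x := p.2)).comp p hasFDerivAt_snd).const_mul (-I)).cexp
  have hs : Real.sqrt p.1 * Real.sqrt p.1 = p.1 := Real.mul_self_sqrt hp.le
  have hs0 : Real.sqrt p.1 ≠ 0 := (Real.sqrt_pos.2 hp).ne'
  have hsc : (Real.sqrt p.1 : ℂ) ≠ 0 := by exact_mod_cast hs0
  have hs' : (p.1 : ℂ) = Real.sqrt p.1 * Real.sqrt p.1 := by exact_mod_cast hs.symm
  refine (h2.mul h1).congr_fderiv ?_
  ext <;> simp [blowDown, real_smul]
  · rw [hs']; field_simp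
  · ring

theorem hasFDerivAt_flat_blowDown {g : ℂ → ℂ} (hg : ContDiff ℝ (⊤ : ℕ∞) g)
    (hz : ∀ n, iteratedFDeriv ℝ n g 0 = 0) (k : ℕ) (p : ℝ × ℝ) :
    HasFDerivAt (fun p : ℝ × ℝ => (p.1⁻¹) ^ k • g (blowDown p))
      ((ContinuousLinearMap.fst ℝ ℝ ℝ).smulRight
          ((-k : ℝ) • ((p.1⁻¹) ^ (k + 1) • g (blowDown p)) +
            (p.1⁻¹) ^ (k + 1) • fderiv ℝ g (blowDown p)
              (((1 / 2 : ℝ) • ContinuousLinearMap.id ℝ ℂ) (blowDown p))) +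
        (ContinuousLinearMap.snd ℝ ℝ ℝ).smulRight
          ((p.1⁻¹) ^ k • fderiv ℝ g (blowDown p)
            (ContinuousLinearMap.mul ℝ ℂ (-I) (blowDown p)))) p := by
  have g0 : ∀ {G : ℂ → ℂ}, (∀ n, iteratedFDeriv ℝ n G 0 = 0) → G 0 = 0 := by
    intro G h
    rw [← norm_eq_zero, ← norm_iteratedFDeriv_zero (𝕜 := ℝ), h, norm_zero]
  have hb : ∀ q : ℝ × ℝ, q.1 ≤ 0 → blowDown q = 0 := by
    intro q hq; rw [← norm_eq_zero, norm_blowDown, Real.sqrt_eq_zero_of_nonpos hq]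
  rcases le_or_gt p.1 0 with hp | hp
  · have e : ∀ L : ℂ →L[ℝ] ℂ, fderiv ℝ g (blowDown p) (L (blowDown p)) = 0 := by
      intro L; rw [hb p hp, map_zero, map_zero]
    rw [e, e, hb p hp, g0 hz]
    simp only [smul_zero, add_zero, ContinuousLinearMap.smulRight_zero]
    obtain ⟨C, hC0, hC⟩ := exists_norm_le_pow_of_flat (2 * k + 4) hg hz
    refine HasFDerivAt.of_isLittleO ?_
    have hbd : (fun q : ℝ × ℝ => (q.1⁻¹) ^ k • g (blowDown q)) =O[nhds p]
        fun q => ‖q - p‖ ^ 2 := by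
      refine Asymptotics.IsBigO.of_bound C ?_
      have hnear : ∀ᶠ q : ℝ × ℝ in nhds p, q.1 < 1 :=
        continuous_fst.continuousAt.eventually_lt continuousAt_const (hp.trans_lt one_pos)
      filter_upwards [hnear] with q hq
      rcases le_or_gt q.1 0 with hq0 | hq0
      · rw [hb q hq0, g0 hz, smul_zero, norm_zero]; positivity
      · have h1 := hC (blowDown q) (by rw [norm_blowDown, Real.sqrt_le_one]; exact hq.le)
        have h2 : ‖blowDown q‖ ^ (2 * k + 4) = q.1 ^ (k + 2) := by
          rw [norm_blowDown, show 2 * k + 4 = 2 * (k + 2) by ring, pow_mul, Real.sq_sqrt hq0.le]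
        have h3 : q.1 ≤ ‖q - p‖ := by
          calc q.1 ≤ (q - p).1 := by simp; exact hp
            _ ≤ ‖(q - p).1‖ := Real.le_norm_self _
            _ ≤ ‖q - p‖ := norm_fst_le _
        rw [h2] at h1
        rw [norm_smul, norm_pow, norm_inv, Real.norm_of_nonneg hq0.le, norm_pow, norm_norm]
        calc (q.1⁻¹) ^ k * ‖g (blowDown q)‖ ≤ (q.1⁻¹) ^ k * (C * q.1 ^ (k + 2)) := by gcongr
          _ = C * q.1 ^ 2 := by rw [pow_add, inv_pow]; field_simp
          _ ≤ C * ‖q - p‖ ^ 2 := by gcongr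
    have hlo : (fun q : ℝ × ℝ => ‖q - p‖ ^ 2) =o[nhds p] fun q => q - p := by
      have := (Asymptotics.isLittleO_norm_pow_id (E' := ℝ × ℝ) one_lt_two).comp_tendsto
        (tendsto_sub_nhds_zero_iff.2 (Filter.tendsto_id (x := nhds p)))
      simpa [Function.comp_def] using this
    simpa [hb p hp, g0 hz] using hbd.trans_isLittleO hlo
  · have h1 : HasFDerivAt (fun q : ℝ × ℝ => (q.1⁻¹) ^ k) _ p :=
      (((hasDerivAt_inv hp.ne').pow k).hasFDerivAt).comp p hasFDerivAt_fst
    have h2 := ((hg.differentiable (by simp) (blowDown p)).hasFDerivAt).comp p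
      (hasFDerivAt_blowDown hp)
    refine (h1.smul h2).congr_fderiv ?_
    have hp' : (p.1 : ℂ) ≠ 0 := by exact_mod_cast hp.ne'
    refine ContinuousLinearMap.ext fun w => ?_
    have e1 : fderiv ℝ g (blowDown p) (w.1 * ((p.1 : ℂ)⁻¹ / 2 * blowDown p)) =
        w.1 * (p.1 : ℂ)⁻¹ * fderiv ℝ g (blowDown p) (2⁻¹ * blowDown p) := by
      have := map_smul (fderiv ℝ g (blowDown p)) (w.1 * p.1⁻¹) (2⁻¹ * blowDown p)
      rw [real_smul, real_smul] at this
      push_cast at this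
      rw [← this]
      ring_nf
    have e2 : fderiv ℝ g (blowDown p) (w.2 * (I * blowDown p)) =
        w.2 * fderiv ℝ g (blowDown p) (I * blowDown p) := by
      simpa only [real_smul] using map_smul (fderiv ℝ g (blowDown p)) w.2 (I * blowDown p)
    simp [real_smul]
    rw [e1, e2]
    rcases k with _ | k
    · simp; ring
    · simp only [Nat.add_sub_cancel]
      field_simp
      ring

theorem contDiff_flat_blowDown {g : ℂ → ℂ} (hg : ContDiff ℝ (⊤ : ℕ∞) g)
    (hz : ∀ n, iteratedFDeriv ℝ n g 0 = 0) :
    ContDiff ℝ (⊤ : ℕ∞) (fun p => g (blowDown p)) := by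
  have key : ∀ (n : ℕ) (k : ℕ) {g : ℂ → ℂ}, ContDiff ℝ (⊤ : ℕ∞) g →
      (∀ n, iteratedFDeriv ℝ n g 0 = 0) →
      ContDiff ℝ n (fun p : ℝ × ℝ => (p.1⁻¹) ^ k • g (blowDown p)) := by
    intro n
    induction n with
    | zero =>
      intro k g hg hz
      exact contDiff_zero.2 (continuous_iff_continuousAt.2 fun p =>
        (hasFDerivAt_flat_blowDown hg hz k p).continuousAt)
    | succ n ih =>
      intro k g hg hz
      refine contDiff_succ_iff_hasFDerivAt.2 ⟨_, ?_, hasFDerivAt_flat_blowDown hg hz k⟩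
      have hA := flat_fderiv_apply hg hz ((1 / 2 : ℝ) • ContinuousLinearMap.id ℝ ℂ)
      have hB := flat_fderiv_apply hg hz (ContinuousLinearMap.mul ℝ ℂ (-I))
      exact (contDiff_const.smulRight
          (((ih (k + 1) hg hz).const_smul _).add (ih (k + 1) hA.1 hA.2))).add
        (contDiff_const.smulRight (ih k hB.1 hB.2))
  refine contDiff_infty.2 fun n => ?_
  simpa using key n 0 hg hz

/-- The power series `∑ (-t)ⁿ / (2n)!`. -/
noncomputable def cosSqrtSeries : FormalMultilinearSeries ℝ ℝ ℝ :=
  FormalMultilinearSeries.ofScalars ℝ (fun n : ℕ => (-1 : ℝ) ^ n / (2 * n).factorial)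

/-- The entire function `t ↦ ∑ (-t)ⁿ / (2n)!`, with `cosSqrt (t²) = cos t`. -/
noncomputable def cosSqrt (t : ℝ) : ℝ := cosSqrtSeries.sum t

theorem cosSqrtSeries_radius : cosSqrtSeries.radius = ⊤ := by
  refine FormalMultilinearSeries.ofScalars_radius_eq_top_of_tendsto ℝ _
    (Filter.Eventually.of_forall fun n => by positivity) ?_
  have h : ∀ n : ℕ, ‖(-1 : ℝ) ^ n.succ / (2 * n.succ).factorial‖ /
      ‖(-1 : ℝ) ^ n / (2 * n).factorial‖ = 1 / ((2 * n + 2) * (2 * n + 1)) := by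
    intro n
    have : ((2 * n.succ).factorial : ℝ) = (2 * n + 2) * (2 * n + 1) * (2 * n).factorial := by
      rw [Nat.succ_eq_add_one, show 2 * (n + 1) = 2 * n + 1 + 1 by ring, Nat.factorial_succ,
        Nat.factorial_succ]
      push_cast; ring
    rw [norm_div, norm_div, norm_pow, norm_pow, norm_neg, norm_one, one_pow, one_pow, this,
      Real.norm_of_nonneg (by positivity), Real.norm_of_nonneg (by positivity)]
    field_simp
  simp_rw [h]
  refine squeeze_zero (fun n => by positivity) (fun n => ?_)
    (tendsto_one_div_add_atTop_nhds_zero_nat (𝕜 := ℝ))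
  apply one_div_le_one_div_of_le (by positivity)
  nlinarith [(Nat.cast_nonneg n : (0 : ℝ) ≤ n)]

theorem contDiff_cosSqrt : ContDiff ℝ (⊤ : ℕ∞) cosSqrt := by
  have h := cosSqrtSeries.hasFPowerSeriesOnBall (by rw [cosSqrtSeries_radius]; simp)
  rw [cosSqrtSeries_radius] at h
  have : AnalyticOnNhd ℝ cosSqrt Set.univ := by
    have := h.analyticOnNhd
    rwa [Metric.eball_top] at this
  exact this.contDiff

theorem cosSqrt_sq (t : ℝ) : cosSqrt (t ^ 2) = Real.cos t := by
  rw [show cosSqrt (t ^ 2) = FormalMultilinearSeries.ofScalarsSum _ (t ^ 2) from rfl,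
    FormalMultilinearSeries.ofScalars_sum_eq, (Real.hasSum_cos t).tsum_eq.symm]
  congr 1; funext n
  rw [smul_eq_mul, pow_mul]; ring

theorem deriv_cosSqrt_sq (x : ℝ) : 2 * x * deriv cosSqrt (x ^ 2) = - Real.sin x := by
  have h1 : HasDerivAt (fun x => cosSqrt (x ^ 2)) _ x :=
    ((contDiff_cosSqrt.differentiable (by simp) (x ^ 2)).hasDerivAt).comp x (hasDerivAt_pow 2 x)
  simp_rw [cosSqrt_sq] at h1
  rw [← h1.unique (Real.hasDerivAt_cos x)]
  simp; ring

theorem contDiff_iteratedDeriv_cosSqrt (k : ℕ) : ContDiff ℝ (⊤ : ℕ∞) (iteratedDeriv k cosSqrt) := by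
  refine contDiff_infty.2 fun n => ?_
  rw [iteratedDeriv_eq_iterate]
  exact (contDiff_cosSqrt.of_le (by exact_mod_cast le_top)).iterate_deriv' n k

theorem cosSqrt_ode (k : ℕ) : ∀ t : ℝ, 0 < t →
    4 * t * iteratedDeriv (k + 2) cosSqrt t + (4 * k + 2) * iteratedDeriv (k + 1) cosSqrt t
      + iteratedDeriv k cosSqrt t = 0 := by
  have hd : ∀ k t, HasDerivAt (iteratedDeriv k cosSqrt) (iteratedDeriv (k + 1) cosSqrt t) t := by
    intro k t
    rw [iteratedDeriv_succ]
    exact ((contDiff_iteratedDeriv_cosSqrt k).differentiable (by simp) t).hasDerivAt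
  induction k with
  | zero =>
    intro t ht
    have h0 := hd 1 (Real.sqrt t ^ 2)
    rw [iteratedDeriv_one] at h0
    have hp : HasDerivAt (fun x => deriv cosSqrt (x ^ 2)) _ (Real.sqrt t) :=
      h0.comp (Real.sqrt t) (h := fun x => x ^ 2) (hasDerivAt_pow 2 (Real.sqrt t))
    have h1 : HasDerivAt (fun x => 2 * x * deriv cosSqrt (x ^ 2)) _ (Real.sqrt t) :=
      ((hasDerivAt_id (Real.sqrt t)).const_mul 2).mul hp
    simp_rw [deriv_cosSqrt_sq] at h1
    have h2 := h1.unique (Real.hasDerivAt_sin _).neg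
    have hc := cosSqrt_sq (Real.sqrt t)
    rw [Real.sq_sqrt ht.le] at h2 hc
    simp only [iteratedDeriv_zero, iteratedDeriv_one, hc, zero_add]
    have hs := Real.sq_sqrt ht.le
    simp at h2
    push_cast
    linear_combination h2 - 4 * iteratedDeriv 2 cosSqrt t * hs
  | succ k ih =>
    intro t ht
    have h1 := ((((hasDerivAt_id t).const_mul 4).mul (hd (k + 2) t)).add
      ((hd (k + 1) t).const_mul (4 * k + 2 : ℝ))).add (hd k t)
    have h2 := h1.congr_of_eventuallyEq (f₁ := fun _ => 0) (by
      filter_upwards [lt_mem_nhds ht] with s hs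
      simpa using (ih s hs).symm)
    have h3 := h2.unique (hasDerivAt_const t 0)
    simp at h3
    push_cast
    linear_combination h3

theorem iteratedDeriv_cosSqrt_bounded (k : ℕ) :
    ∃ M : ℝ, ∀ t : ℝ, 1 ≤ t → ‖iteratedDeriv k cosSqrt t‖ ≤ M := by
  induction k using Nat.twoStepInduction with
  | zero =>
    refine ⟨1, fun t ht => ?_⟩
    have := cosSqrt_sq (Real.sqrt t)
    rw [Real.sq_sqrt (by linarith)] at this
    rw [iteratedDeriv_zero, this]
    exact Real.abs_cos_le_one _
  | one =>
    refine ⟨1, fun t ht => ?_⟩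
    have h := deriv_cosSqrt_sq (Real.sqrt t)
    rw [Real.sq_sqrt (by linarith)] at h
    have h1 : 1 ≤ Real.sqrt t := Real.one_le_sqrt.2 ht
    have h2 := congrArg abs h
    rw [abs_neg, abs_mul, abs_of_nonneg (by positivity)] at h2
    rw [iteratedDeriv_one, Real.norm_eq_abs]
    nlinarith [Real.abs_sin_le_one (Real.sqrt t), abs_nonneg (deriv cosSqrt t)]
  | more k h0 h1 =>
    obtain ⟨M0, h0⟩ := h0
    obtain ⟨M1, h1⟩ := h1
    refine ⟨(4 * k + 2) * M1 + M0, fun t ht => ?_⟩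
    have h := cosSqrt_ode k t (by linarith)
    have e : 4 * t * iteratedDeriv (k + 2) cosSqrt t =
      -((4 * k + 2) * iteratedDeriv (k + 1) cosSqrt t + iteratedDeriv k cosSqrt t) := by
      linear_combination h
    have h2 : ‖4 * t * iteratedDeriv (k + 2) cosSqrt t‖ ≤ (4 * k + 2) * M1 + M0 := by
      rw [e, norm_neg]
      refine (norm_add_le _ _).trans (add_le_add ?_ (h0 t ht))
      rw [norm_mul, Real.norm_of_nonneg (by positivity)]
      exact mul_le_mul_of_nonneg_left (h1 t ht) (by positivity)
    rw [norm_mul, Real.norm_of_nonneg (by linarith)] at h2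
    nlinarith [norm_nonneg (iteratedDeriv (k + 2) cosSqrt t)]

theorem exists_bounded_cosSqrt : ∃ C : ℝ → ℝ, ContDiff ℝ (⊤ : ℕ∞) C ∧
    (∀ t, C (t ^ 2) = Real.cos t) ∧
    ∀ k : ℕ, ∃ M : ℝ, ∀ t, ‖iteratedDeriv k C t‖ ≤ M := by
  have hC : ContDiff ℝ (⊤ : ℕ∞) (fun t => Real.smoothTransition (t + 1) * cosSqrt t) :=
    (Real.smoothTransition.contDiff.comp (contDiff_id.add contDiff_const)).mul contDiff_cosSqrt
  refine ⟨_, hC, fun t => ?_, fun k => ?_⟩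
  · rw [Real.smoothTransition.one_of_one_le (by nlinarith [sq_nonneg t]), one_mul, cosSqrt_sq]
  · obtain ⟨M1, h1⟩ := iteratedDeriv_cosSqrt_bounded k
    obtain ⟨M2, h2⟩ := (isCompact_Icc (a := (-2 : ℝ)) (b := 1)).exists_bound_of_continuousOn
      (hC.continuous_iteratedDeriv k (by exact_mod_cast le_top)).continuousOn
    refine ⟨max 0 (max M1 M2), fun t => ?_⟩
    rcases lt_or_ge t (-2) with ht | ht
    · have : (fun t => Real.smoothTransition (t + 1) * cosSqrt t) =ᶠ[nhds t] fun _ => 0 := by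
        filter_upwards [gt_mem_nhds ht] with s hs
        rw [Real.smoothTransition.zero_of_nonpos (by linarith), zero_mul]
      rw [this.iteratedDeriv_eq]
      simp
    rcases le_or_gt t 1 with ht1 | ht1
    · exact (h2 t ⟨ht, ht1⟩).trans ((le_max_right _ _).trans (le_max_right _ _))
    · have : (fun t => Real.smoothTransition (t + 1) * cosSqrt t) =ᶠ[nhds t] cosSqrt := by
        filter_upwards [lt_mem_nhds ht1] with s hs
        rw [Real.smoothTransition.one_of_one_le (by linarith), one_mul]
      rw [this.iteratedDeriv_eq]
      exact (h1 t ht1.le).trans ((le_max_left _ _).trans (le_max_right _ _))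

theorem contDiff_integral_comp_linear {W E : Type} [MeasurableSpace W] [TopologicalSpace W]
    [BorelSpace W] [SecondCountableTopology W] {μ : Measure W} [NormedAddCommGroup E]
    [NormedSpace ℝ E] [FiniteDimensional ℝ E]
    {L : W → E →L[ℝ] ℝ} (hL : Continuous L) (n : ℕ) :
    ∀ {F : Type} [NormedAddCommGroup F] [NormedSpace ℝ F] [CompleteSpace F]
      {ψ : W → F} {C : ℝ → ℝ}, Continuous ψ → (∀ k : ℕ, Integrable (fun w => ‖L w‖ ^ k * ‖ψ w‖) μ) →
      ContDiff ℝ (⊤ : ℕ∞) C → (∀ k : ℕ, ∃ M : ℝ, ∀ t, ‖iteratedDeriv k C t‖ ≤ M) →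
      ContDiff ℝ n (fun p : E => ∫ w, C (L w p) • ψ w ∂μ) := by
  have hasFD : ∀ {F : Type} [NormedAddCommGroup F] [NormedSpace ℝ F] [CompleteSpace F]
      {ψ : W → F} {C : ℝ → ℝ}, Continuous ψ → (∀ k : ℕ, Integrable (fun w => ‖L w‖ ^ k * ‖ψ w‖) μ) →
      ContDiff ℝ (⊤ : ℕ∞) C → (∀ k : ℕ, ∃ M : ℝ, ∀ t, ‖iteratedDeriv k C t‖ ≤ M) →
      ∀ p, HasFDerivAt (fun p : E => ∫ w, C (L w p) • ψ w ∂μ)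
        (∫ w, deriv C (L w p) • (L w).smulRight (ψ w) ∂μ) p := by
    intro F _ _ _ ψ C hψ hint hC hbd p
    obtain ⟨M0, h0⟩ := hbd 0
    obtain ⟨M1, h1⟩ := hbd 1
    simp only [iteratedDeriv_zero] at h0
    simp only [iteratedDeriv_one] at h1
    have hC' : Continuous (deriv C) := hC.continuous_deriv (by simp)
    have hcont : ∀ q : E, Continuous (fun w => C (L w q) • ψ w) := fun q =>
      (hC.continuous.comp (hL.clm_apply continuous_const)).smul hψ
    have hcont' : Continuous (fun w => deriv C (L w p) • (L w).smulRight (ψ w)) :=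
      (hC'.comp (hL.clm_apply continuous_const)).smul
        (((ContinuousLinearMap.smulRightL ℝ E F).continuous₂).comp (hL.prodMk hψ))
    refine hasFDerivAt_integral_of_dominated_of_fderiv_le (s := Set.univ)
      (F := fun q w => C (L w q) • ψ w)
      (F' := fun q w => deriv C (L w q) • (L w).smulRight (ψ w))
      (bound := fun w => M1 * (‖L w‖ ^ 1 * ‖ψ w‖)) Filter.univ_mem ?_ ?_ ?_ ?_ ?_ ?_
    · exact Filter.Eventually.of_forall fun q => (hcont q).aestronglyMeasurable
    · refine ((hint 0).const_mul M0).mono' (hcont p).aestronglyMeasurable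
        (Filter.Eventually.of_forall fun w => ?_)
      rw [norm_smul, pow_zero, one_mul]
      exact mul_le_mul_of_nonneg_right (h0 _) (norm_nonneg _)
    · exact hcont'.aestronglyMeasurable
    · refine Filter.Eventually.of_forall fun w q _ => ?_
      rw [norm_smul, ContinuousLinearMap.norm_smulRight_apply, pow_one]
      exact mul_le_mul_of_nonneg_right (h1 _) (by positivity)
    · exact (hint 1).const_mul M1
    · refine Filter.Eventually.of_forall fun w q _ => ?_
      have h2 : HasFDerivAt (fun q => C (L w q)) _ q :=
        ((hC.differentiable (by simp) (L w q)).hasDerivAt.hasFDerivAt).comp q (L w).hasFDerivAt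
      refine (h2.smul_const (ψ w)).congr_fderiv ?_
      ext v
      simp [smul_smul, mul_comm]
  induction n with
  | zero =>
    intro F _ _ _ ψ C hψ hint hC hbd
    exact contDiff_zero.2 (continuous_iff_continuousAt.2 fun p =>
      (hasFD hψ hint hC hbd p).continuousAt)
  | succ n ih =>
    intro F _ _ _ ψ C hψ hint hC hbd
    refine contDiff_succ_iff_hasFDerivAt.2 ⟨_, ?_, hasFD hψ hint hC hbd⟩
    refine ih ?_ ?_ ?_ ?_
    · exact ((ContinuousLinearMap.smulRightL ℝ E F).continuous₂).comp (hL.prodMk hψ)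
    · intro k
      refine (hint (k + 1)).congr (Filter.Eventually.of_forall fun w => ?_)
      simp only [ContinuousLinearMap.norm_smulRight_apply]
      ring
    · exact (contDiff_infty_iff_deriv.1 hC).2
    · intro k
      obtain ⟨M, hM⟩ := hbd (k + 1)
      exact ⟨M, fun t => by rw [← iteratedDeriv_succ']; exact hM t⟩

/-- The linear form `(ζ, s) ↦ 2π² (s|w|² + Re (ζ (conj w)²))`, whose value at `(z², |z|²)` is
`(2π⟪w, z⟫)²`. -/
noncomputable def squaredPhase (w : ℂ) : ℂ × ℝ →L[ℝ] ℝ :=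
  (2 * Real.pi ^ 2) • (‖w‖ ^ 2 • ContinuousLinearMap.snd ℝ ℂ ℝ +
    (reCLM ∘L ContinuousLinearMap.mul ℝ ℂ (starRingEnd ℂ w ^ 2)) ∘L
      ContinuousLinearMap.fst ℝ ℂ ℝ)

theorem continuous_squaredPhase : Continuous squaredPhase := by
  have h : Continuous fun w : ℂ => ContinuousLinearMap.mul ℝ ℂ (starRingEnd ℂ w ^ 2) :=
    (ContinuousLinearMap.mul ℝ ℂ).continuous.comp (continuous_conj.pow 2)
  unfold squaredPhase
  fun_prop

theorem norm_squaredPhase_le (w : ℂ) : ‖squaredPhase w‖ ≤ 4 * Real.pi ^ 2 * ‖w‖ ^ 2 := by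
  refine ContinuousLinearMap.opNorm_le_bound _ (by positivity) fun p => ?_
  have h1 : |p.2| ≤ ‖p‖ := norm_snd_le p
  have h2 : |(starRingEnd ℂ w ^ 2 * p.1).re| ≤ ‖w‖ ^ 2 * ‖p‖ := by
    refine (abs_re_le_norm _).trans ?_
    rw [norm_mul, norm_pow, norm_conj]
    gcongr
    exact norm_fst_le p
  have h3 : |‖w‖ ^ 2 * p.2| ≤ ‖w‖ ^ 2 * ‖p‖ := by
    rw [abs_mul, abs_of_nonneg (by positivity : 0 ≤ ‖w‖ ^ 2)]
    gcongr
  have h4 : squaredPhase w p =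
      2 * Real.pi ^ 2 * (‖w‖ ^ 2 * p.2 + (starRingEnd ℂ w ^ 2 * p.1).re) := rfl
  rw [h4, norm_mul, Real.norm_of_nonneg (by positivity), Real.norm_eq_abs]
  calc _ ≤ 2 * Real.pi ^ 2 * (‖w‖ ^ 2 * ‖p‖ + ‖w‖ ^ 2 * ‖p‖) := by
        gcongr
        exact (abs_add_le _ _).trans (add_le_add h3 h2)
    _ = _ := by ring

theorem squaredPhase_sq (w z : ℂ) :
    squaredPhase w (z ^ 2, ‖z‖ ^ 2) = (2 * Real.pi * inner ℝ w z) ^ 2 := by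
  have h4 : squaredPhase w (z ^ 2, ‖z‖ ^ 2) =
      2 * Real.pi ^ 2 * (‖w‖ ^ 2 * ‖z‖ ^ 2 + (starRingEnd ℂ w ^ 2 * z ^ 2).re) := rfl
  rw [h4, Complex.inner, ← normSq_eq_norm_sq, ← normSq_eq_norm_sq, normSq_apply, normSq_apply]
  simp [pow_two]
  ring

open scoped FourierTransform SchwartzMap in
theorem SchwartzMap.exists_smooth_even_part (φ : 𝓢(ℂ, ℂ)) :
    ∃ H : ℂ × ℝ → ℂ, ContDiff ℝ (⊤ : ℕ∞) H ∧
      ∀ z : ℂ, H (z ^ 2, ‖z‖ ^ 2) = (1 / 2 : ℝ) • (φ z + φ (-z)) := by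
  obtain ⟨C, hC, hCcos, hCbd⟩ := exists_bounded_cosSqrt
  refine ⟨fun p => ∫ w, C (squaredPhase w p) • (𝓕 φ) w, ?_, fun z => ?_⟩
  · refine contDiff_infty.2 fun n => contDiff_integral_comp_linear continuous_squaredPhase n
      (𝓕 φ).continuous (fun k => ?_) hC hCbd
    refine (((𝓕 φ).integrable_pow_mul volume (2 * k)).const_mul ((4 * Real.pi ^ 2) ^ k)).mono'
      ((continuous_squaredPhase.norm.pow k).mul (𝓕 φ).continuous.norm).aestronglyMeasurable
      (Filter.Eventually.of_forall fun w => ?_)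
    rw [Real.norm_of_nonneg (by positivity), ← mul_assoc, pow_mul, ← mul_pow]
    gcongr
    exact norm_squaredPhase_le w
  · have hinv : ∀ z, φ z = ∫ w, exp (((2 * Real.pi * inner ℝ w z : ℝ) : ℂ) * I) • (𝓕 φ) w := by
      intro z
      rw [← Real.fourierInv_eq', ← SchwartzMap.fourierInv_coe]
      simp
    have hint : ∀ z, Integrable
        (fun w => exp (((2 * Real.pi * inner ℝ w z : ℝ) : ℂ) * I) • (𝓕 φ) w) := by
      intro z
      refine (𝓕 φ).integrable.norm.mono' (Continuous.aestronglyMeasurable ?_)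
        (Filter.Eventually.of_forall fun w => ?_)
      · have := (𝓕 φ).continuous
        fun_prop
      · rw [norm_smul, norm_exp_ofReal_mul_I, one_mul]
    rw [hinv z, hinv (-z), ← integral_add (hint z) (hint (-z)), ← integral_smul]
    refine integral_congr_ae (Filter.Eventually.of_forall fun w => ?_)
    dsimp only
    rw [squaredPhase_sq, hCcos, inner_neg_right, real_smul, real_smul, ofReal_cos, Complex.cos]
    simp only [smul_eq_mul]
    push_cast
    ring_nf

theorem exists_extension_of_jet_even {f : ℂ → ℂ} (hf : ContDiff ℝ (⊤ : ℕ∞) f)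
    (hjet : ∀ n : ℕ, iteratedFDeriv ℝ n f 0 = iteratedFDeriv ℝ n (fun z => f (-z)) 0) :
    ∃ F : ℝ × ℝ → ℂ, ContDiff ℝ (⊤ : ℕ∞) F ∧
      (∀ s θ : ℝ, F (s, θ + 2 * Real.pi) = F (s, θ)) ∧
      (∀ s θ : ℝ, 0 ≤ s → F (s, θ) = f (exp (-I * θ) * Real.sqrt s)) := by
  let χ : ContDiffBump (0 : ℂ) := ⟨1, 2, one_pos, one_lt_two⟩
  have hχf : ContDiff ℝ (⊤ : ℕ∞) (fun z => χ z • f z) := χ.contDiff.smul hf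
  have hsupp : HasCompactSupport (fun z => χ z • f z) := χ.hasCompactSupport.smul_right
  let φ := hsupp.toSchwartzMap hχf
  have hφ : ∀ z, φ z = χ z • f z := fun z => rfl
  obtain ⟨H, hH, hHφ⟩ := φ.exists_smooth_even_part
  have hφs : ContDiff ℝ (⊤ : ℕ∞) φ := hχf
  have hfn : ContDiff ℝ (⊤ : ℕ∞) (fun z => f (-z)) := hf.comp contDiff_neg
  set g : ℂ → ℂ := fun z => f z - (1 / 2 : ℝ) • (φ z + φ (-z)) with hg
  have hgs : ContDiff ℝ (⊤ : ℕ∞) g :=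
    hf.sub ((hφs.add (hφs.comp contDiff_neg)).const_smul _)
  have hgz : ∀ n, iteratedFDeriv ℝ n g 0 = 0 := by
    intro n
    have hle : ((n : ℕ) : WithTop ℕ∞) ≤ (⊤ : ℕ∞) := by exact_mod_cast le_top
    have hloc : g =ᶠ[nhds 0] (1 / 2 : ℝ) • (f - fun z => f (-z)) := by
      have h1 : ∀ᶠ z : ℂ in nhds 0, χ z = 1 := χ.eventuallyEq_one
      have h2 : ∀ᶠ z : ℂ in nhds 0, χ (-z) = 1 := by
        have : Filter.Tendsto (fun z : ℂ => -z) (nhds 0) (nhds 0) := by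
          simpa using (continuous_neg (G := ℂ)).tendsto 0
        exact this.eventually h1
      filter_upwards [h1, h2] with z hz hz'
      simp only [hg, hφ, hz, hz', Pi.smul_apply, Pi.sub_apply, real_smul]
      push_cast
      ring
    have hsub : ContDiff ℝ n (f - fun z => f (-z)) := (hf.sub hfn).of_le hle
    rw [(hloc.iteratedFDeriv ℝ n).eq_of_nhds, iteratedFDeriv_const_smul_apply hsub.contDiffAt,
      iteratedFDeriv_sub_apply (hf.of_le hle).contDiffAt
      (hfn.of_le hle).contDiffAt, hjet n, sub_self, smul_zero]
  have hper : ∀ θ : ℝ, exp (-I * ((θ + 2 * Real.pi : ℝ) : ℂ)) = exp (-I * θ) := by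
    intro θ
    push_cast
    rw [mul_add, exp_add, show -I * (2 * (Real.pi : ℂ)) = -(2 * Real.pi * I) by ring,
      exp_neg (2 * Real.pi * I), exp_two_pi_mul_I]
    norm_num
  refine ⟨fun p => H (p.1 * exp (-I * p.2) ^ 2, p.1) + g (blowDown p), ?_, ?_, ?_⟩
  · refine ContDiff.add (hH.comp ?_) (contDiff_flat_blowDown hgs hgz)
    have h1 : ContDiff ℝ (⊤ : ℕ∞) (fun p : ℝ × ℝ => (p.1 : ℂ)) :=
      ofRealCLM.contDiff.comp contDiff_fst
    have h2 : ContDiff ℝ (⊤ : ℕ∞) (fun p : ℝ × ℝ => (p.2 : ℂ)) :=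
      ofRealCLM.contDiff.comp contDiff_snd
    exact (h1.mul ((contDiff_const.mul h2).cexp.pow 2)).prodMk contDiff_fst
  · intro s θ
    simp only [blowDown, hper]
  · intro s θ hs
    have h1 : ((s : ℂ) * exp (-I * θ) ^ 2, s) =
        (blowDown (s, θ) ^ 2, ‖blowDown (s, θ)‖ ^ 2) := by
      rw [norm_blowDown, Real.sq_sqrt hs, blowDown, mul_pow, ← ofReal_pow, Real.sq_sqrt hs,
        mul_comm]
    dsimp only
    rw [h1, hHφ, hg]
    simp [blowDown]

/-- Theorem 2.3: for a smooth `f : ℂ → ℂ`, the pullback `σ* f`, where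
`σ(s,θ) = e^{-iθ}√s`, extends from `[0,∞) × S¹` to a smooth function on `T*S¹ = ℝ × S¹`
iff the infinite jet of `f` at `0` is even (invariant under `z ↦ -z`). -/
theorem statement7 (f : ℂ → ℂ) (hf : ContDiff ℝ (⊤ : ℕ∞) f) :
    (∃ F : ℝ × ℝ → ℂ, ContDiff ℝ (⊤ : ℕ∞) F ∧
        (∀ s θ : ℝ, F (s, θ + 2 * Real.pi) = F (s, θ)) ∧
        (∀ s θ : ℝ, 0 ≤ s → F (s, θ) = f (Complex.exp (-Complex.I * θ) * Real.sqrt s))) ↔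
    (∀ n : ℕ, iteratedFDeriv ℝ n f 0 = iteratedFDeriv ℝ n (fun z => f (-z)) 0) := by
  constructor
  · rintro ⟨F, hF, -, hFf⟩ n
    exact jet_even_of_extension hf hF hFf n
  · exact exists_extension_of_jet_even hf
end

section
/- Let n be a natural number, d a real number, and q : ℝⁿ × ℝ → ℂ a function such that for every ξ ∈ ℝⁿ the map s ↦ q(ξ, s) is infinitely differentiable, and such that: (a) for every natural number j there is a constant C_j with ‖(d/ds)^j q(ξ, s)‖ ≤ C_j·(1 + ‖ξ‖ + |s|)^{d−j} for all (ξ, s); and (b) (d/ds)^j q(ξ, 0) = 0 for all j and all ξ (the symbol vanishes to infinite order at s = 0). Then for every natural number N with N ≥ d there is a constant C_N' with ‖q(ξ, s)‖ ≤ C_N'·|s|^N·(1 + ‖ξ‖)^{d−N} for all (ξ, s). -/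
/-- A smooth function on `ℝ` whose derivatives of order less than `N` vanish at `0` and whose
derivative of order `N` is bounded by `M` is bounded by `M * |s| ^ N`. -/
theorem norm_le_mul_abs_pow_of_iteratedDeriv_eq_zero {E : Type*} [NormedAddCommGroup E]
    [NormedSpace ℝ E] {M : ℝ} {N : ℕ} {f : ℝ → E} (hf : ContDiff ℝ (⊤ : ℕ∞) f)
    (h0 : ∀ j < N, iteratedDeriv j f 0 = 0) (hM : ∀ s, ‖iteratedDeriv N f s‖ ≤ M) (s : ℝ) :
    ‖f s‖ ≤ M * |s| ^ N := by
  induction N generalizing f s with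
  | zero => simpa using hM s
  | succ N ih =>
    have hM0 : 0 ≤ M := (norm_nonneg _).trans (hM 0)
    have hderiv (t : ℝ) : ‖deriv f t‖ ≤ M * |t| ^ N := by
      refine ih (contDiff_infty_iff_deriv.1 hf).2 (fun j hj => ?_) (fun r => ?_) t
      · rw [← iteratedDeriv_succ']
        exact h0 (j + 1) (by lia)
      · rw [← iteratedDeriv_succ']
        exact hM r
    have hmv := (convex_closedBall (0 : ℝ) |s|).norm_image_sub_le_of_norm_deriv_le
      (f := f) (C := M * |s| ^ N) (x := 0) (y := s)
      (fun t _ => (contDiff_infty_iff_deriv.1 hf).1 t)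
      (fun t ht => (hderiv t).trans (by
        have : |t| ≤ |s| := by simpa using ht
        gcongr))
      (by simp) (by simp)
    have hf0 : f 0 = 0 := by simpa using h0 0 N.succ_pos
    rw [hf0, sub_zero, sub_zero, Real.norm_eq_abs] at hmv
    rwa [pow_succ, ← mul_assoc]

/-- If a symbol `q(ξ, s)` of order `d` (in the sense of the `s`-derivative estimates (a))
vanishes to infinite order at `s = 0`, then for every `N ≥ d` one has
`‖q(ξ,s)‖ ≤ C·|s|^N·(1+‖ξ‖)^{d-N}`.  This is the key estimate in the proof that a
pseudodifferential operator whose total symbol vanishes to infinite order on `{s = 0}`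
commutes with the Szegő projector modulo smoothing operators (Theorem 3.5). -/
theorem statement18 (n : ℕ) (d : ℝ) (q : EuclideanSpace ℝ (Fin n) × ℝ → ℂ)
    (hsmooth : ∀ ξ : EuclideanSpace ℝ (Fin n), ContDiff ℝ (⊤ : ℕ∞) fun s : ℝ => q (ξ, s))
    (hbound : ∀ j : ℕ, ∃ C : ℝ, ∀ (ξ : EuclideanSpace ℝ (Fin n)) (s : ℝ),
        ‖iteratedDeriv j (fun t : ℝ => q (ξ, t)) s‖ ≤ C * (1 + ‖ξ‖ + |s|) ^ (d - (j : ℝ)))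
    (hflat : ∀ (j : ℕ) (ξ : EuclideanSpace ℝ (Fin n)),
        iteratedDeriv j (fun t : ℝ => q (ξ, t)) 0 = 0) :
    ∀ N : ℕ, d ≤ N → ∃ C' : ℝ, ∀ (ξ : EuclideanSpace ℝ (Fin n)) (s : ℝ),
        ‖q (ξ, s)‖ ≤ C' * |s| ^ N * (1 + ‖ξ‖) ^ (d - (N : ℝ)) := by
  intro N hN
  obtain ⟨C, hC⟩ := hbound N
  refine ⟨|C|, fun ξ s => ?_⟩
  rw [mul_right_comm]
  refine norm_le_mul_abs_pow_of_iteratedDeriv_eq_zero (hsmooth ξ) (fun j _ => hflat j ξ)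
    (fun t => (hC ξ t).trans ?_) s
  have hpow : (1 + ‖ξ‖ + |t|) ^ (d - (N : ℝ)) ≤ (1 + ‖ξ‖) ^ (d - (N : ℝ)) :=
    Real.rpow_le_rpow_of_nonpos (by positivity) (by simp) (by linarith)
  calc C * (1 + ‖ξ‖ + |t|) ^ (d - (N : ℝ))
      ≤ |C| * (1 + ‖ξ‖ + |t|) ^ (d - (N : ℝ)) := by gcongr; exact le_abs_self C
    _ ≤ |C| * (1 + ‖ξ‖) ^ (d - (N : ℝ)) := by gcongr
end
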